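/- arXiv:2501.12576 — 2 statements merged into one kernel-verified Lean document; each statement's English description precedes it below -/
import Mathlib

section
/- Let K, N be positive integers, R : Fin K → ℝ antitone, C : Fin N → ℝ monotone, and let j ≤ min(K, N) satisfy R(i) ≥ C(i) for all i < j and either j = min(K, N) or R(j) < C(j); assume W := ∑_{i=0}^{j−1}(R(i) − C(i)) > 0. Let b : Fin K → ℝ and q : Fin N → ℝ satisfy b̲ ≤ b(k) ≤ b̄ and b̲ ≤ q(n) ≤ b̄ with 0 < b̲ ≤ b̄. Then for every feasible partial matching (ι, σ) of any size s ≤ min(K, N) (i.e., injections with R(ι i) ≥ C(σ i) for each i) and every bijection τ : Fin j → Fin j with R(i) ≥ C(τ(i)) for all i, one has [∑_{i : Fin s} min(b(ι i), q(σ i))(R(ι i) − C(σ i))] / [∑_{i : Fin j} min(b(i), q(τ(i)))(R(i) − C(τ(i)))] ≤ b̄ / b̲. In particular the ratio of the optimal quantity-weighted surplus to the surplus of any feasible permutation matching of the top j pairs is at most b̄/b̲ (the essence of Theorem 3's bound PoA ≤ b̄/b̲). -/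
/-- If `f` is nonnegative on the range of an injection `g` and nonpositive off it, then the sum of
`f` along any injection is at most its sum along `g`. -/
theorem sum_comp_le_of_sign {α β γ : Type*} [Fintype α] [Fintype β] [Fintype γ]
    {f : γ → ℝ} {e : α → γ} {g : β → γ} (he : Function.Injective e)
    (hg : Function.Injective g) (hpos : ∀ x, 0 ≤ f (g x)) (hneg : ∀ y ∉ Set.range g, f y ≤ 0) :
    ∑ x, f (e x) ≤ ∑ x, f (g x) := by
  classical
  calc ∑ x, f (e x) ≤ ∑ x, max (f (e x)) 0 := Finset.sum_le_sum fun _ _ => le_max_left _ _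
    _ = ∑ y ∈ Finset.univ.image e, max (f y) 0 := by
      rw [Finset.sum_image he.injOn]
    _ ≤ ∑ y, max (f y) 0 :=
      Finset.sum_le_sum_of_subset_of_nonneg (Finset.subset_univ _) fun _ _ _ => le_max_right _ _
    _ = ∑ y ∈ Finset.univ.image g, max (f y) 0 := by
      refine (Finset.sum_subset (Finset.subset_univ _) fun y _ hy => max_eq_right ?_).symm
      exact hneg y (by simpa using hy)
    _ = ∑ x, max (f (g x)) 0 := Finset.sum_image hg.injOn
    _ = ∑ x, f (g x) := Finset.sum_congr rfl fun x _ => max_eq_left (hpos x)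

/-- A price separating the first `j` indices from the others on both sides of the market. -/
theorem exists_clearing_price {K N j : ℕ} {R : Fin K → ℝ} {C : Fin N → ℝ}
    (hR : Antitone R) (hC : Monotone C) (hj0 : 0 < j) (hjK : j ≤ K) (hjN : j ≤ N)
    (hfeas : ∀ i : Fin j, C (Fin.castLE hjN i) ≤ R (Fin.castLE hjK i))
    (hedge : ∀ (h1 : j < K) (h2 : j < N), R ⟨j, h1⟩ ≤ C ⟨j, h2⟩) :
    ∃ p : ℝ, (∀ i : Fin j, p ≤ R (Fin.castLE hjK i)) ∧ (∀ i : Fin j, C (Fin.castLE hjN i) ≤ p) ∧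
      (∀ k : Fin K, j ≤ k → R k ≤ p) ∧ ∀ n : Fin N, j ≤ n → p ≤ C n := by
  let l : Fin j := ⟨j - 1, by omega⟩
  have hl : ∀ i : Fin j, i ≤ l := fun i => Fin.le_def.2 (show (i : ℕ) ≤ j - 1 by omega)
  have hRl : ∀ i : Fin j, R (Fin.castLE hjK l) ≤ R (Fin.castLE hjK i) := fun i => hR (hl i)
  have hCl : ∀ i : Fin j, C (Fin.castLE hjN i) ≤ R (Fin.castLE hjK l) := fun i =>
    (hC (hl i : Fin.castLE hjN i ≤ Fin.castLE hjN l)).trans (hfeas l)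
  have hRk : ∀ k : Fin K, j ≤ k → R k ≤ R (Fin.castLE hjK l) := fun k hk =>
    hR (Fin.le_def.2 (show j - 1 ≤ (k : ℕ) by omega))
  by_cases h : j < N
  · refine ⟨min (R (Fin.castLE hjK l)) (C ⟨j, h⟩), fun i => (min_le_left _ _).trans (hRl i),
      fun i => le_min (hCl i) (hC (Fin.le_def.2 i.2.le)), fun k hk => le_min (hRk k hk) ?_,
      fun n hn => (min_le_right _ _).trans (hC (Fin.le_def.2 hn))⟩
    exact (hR (Fin.le_def.2 hk)).trans (hedge (hk.trans_lt k.2) h)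
  · exact ⟨R (Fin.castLE hjK l), hRl, hCl, hRk, fun n hn => absurd (hn.trans_lt n.2) h⟩

/-- PoA bound (essence of Theorem 3): the ratio between the quantity-weighted surplus
of any feasible partial matching (in particular the optimum) and the quantity-weighted
surplus of any feasible permutation matching of the top `j` pairs is at most `b̄ / b̲`,
when all trading quantities lie in `[b̲, b̄]` with `0 < b̲ ≤ b̄`. -/
theorem poa_bound_heterogeneous_quantities
    (K N j : ℕ) (hK : 0 < K) (hN : 0 < N)
    (R : Fin K → ℝ) (C : Fin N → ℝ)
    (hR : Antitone R) (hC : Monotone C)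
    (hj : j ≤ min K N)
    (hfeasj : ∀ i : Fin j,
      C (Fin.castLE (hj.trans (min_le_right K N)) i) ≤
        R (Fin.castLE (hj.trans (min_le_left K N)) i))
    (hedge : j = min K N ∨
      ∀ (h1 : j < K) (h2 : j < N), R ⟨j, h1⟩ < C ⟨j, h2⟩)
    (hW : 0 < ∑ i : Fin j, (R (Fin.castLE (hj.trans (min_le_left K N)) i)
      - C (Fin.castLE (hj.trans (min_le_right K N)) i)))
    (blo bbar : ℝ) (hblo : 0 < blo) (hlohi : blo ≤ bbar)
    (b : Fin K → ℝ) (q : Fin N → ℝ)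
    (hb : ∀ k, blo ≤ b k ∧ b k ≤ bbar) (hq : ∀ n, blo ≤ q n ∧ q n ≤ bbar)
    (s : ℕ) (hs : s ≤ min K N)
    (ι : Fin s → Fin K) (σ : Fin s → Fin N)
    (hι : Function.Injective ι) (hσ : Function.Injective σ)
    (hfeas : ∀ i : Fin s, C (σ i) ≤ R (ι i))
    (τ : Equiv.Perm (Fin j))
    (hfeasτ : ∀ i : Fin j,
      C (Fin.castLE (hj.trans (min_le_right K N)) (τ i)) ≤
        R (Fin.castLE (hj.trans (min_le_left K N)) i)) :
    (∑ i : Fin s, min (b (ι i)) (q (σ i)) * (R (ι i) - C (σ i)))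
      / (∑ i : Fin j, min (b (Fin.castLE (hj.trans (min_le_left K N)) i))
            (q (Fin.castLE (hj.trans (min_le_right K N)) (τ i)))
          * (R (Fin.castLE (hj.trans (min_le_left K N)) i)
            - C (Fin.castLE (hj.trans (min_le_right K N)) (τ i))))
      ≤ bbar / blo := by
  have hjK : j ≤ K := hj.trans (min_le_left K N)
  have hjN : j ≤ N := hj.trans (min_le_right K N)
  have hj0 : 0 < j := by
    rcases Nat.eq_zero_or_pos j with rfl | h
    · simp at hW
    · exact h
  obtain ⟨p, hpR, hpC, hRp, hCp⟩ := exists_clearing_price hR hC hj0 hjK hjN hfeasj fun h1 h2 =>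
    hedge.elim (fun h => by omega) fun h => (h h1 h2).le
  have hbuy : ∑ i, (R (ι i) - p) ≤ ∑ i, (R (Fin.castLE hjK i) - p) :=
    sum_comp_le_of_sign (f := fun k => R k - p) hι (Fin.castLE_injective hjK)
      (fun i => sub_nonneg.2 (hpR i)) fun k hk => sub_nonpos.2 <| hRp k <| by
        by_contra! h
        exact hk ⟨⟨k, h⟩, rfl⟩
  have hsell : ∑ i, (p - C (σ i)) ≤ ∑ i, (p - C (Fin.castLE hjN i)) :=
    sum_comp_le_of_sign (f := fun n => p - C n) hσ (Fin.castLE_injective hjN)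
      (fun i => sub_nonneg.2 (hpC i)) fun n hn => sub_nonpos.2 <| hCp n <| by
        by_contra! h
        exact hn ⟨⟨n, h⟩, rfl⟩
  set W := ∑ i : Fin j, (R (Fin.castLE hjK i) - C (Fin.castLE hjN i)) with hWdef
  have hsurplus : ∑ i, (R (ι i) - C (σ i)) ≤ W := by
    simp only [hWdef, Finset.sum_sub_distrib] at hbuy hsell ⊢
    simp only [Finset.sum_const] at hbuy hsell
    linarith
  have hperm : ∑ i, (R (Fin.castLE hjK i) - C (Fin.castLE hjN (τ i))) = W := by
    simp only [hWdef, Finset.sum_sub_distrib]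
    rw [Equiv.sum_comp τ fun i => C (Fin.castLE hjN i)]
  have hnum : ∑ i, min (b (ι i)) (q (σ i)) * (R (ι i) - C (σ i)) ≤ bbar * W := by
    refine le_trans ?_ (mul_le_mul_of_nonneg_left hsurplus (hblo.le.trans hlohi))
    rw [Finset.mul_sum]
    exact Finset.sum_le_sum fun i _ => mul_le_mul_of_nonneg_right
      ((min_le_left _ _).trans (hb _).2) (sub_nonneg.2 (hfeas i))
  have hden : blo * W ≤ ∑ i, min (b (Fin.castLE hjK i)) (q (Fin.castLE hjN (τ i))) *
      (R (Fin.castLE hjK i) - C (Fin.castLE hjN (τ i))) := by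
    rw [← hperm, Finset.mul_sum]
    exact Finset.sum_le_sum fun i _ => mul_le_mul_of_nonneg_right
      (le_min (hb _).1 (hq _).1) (sub_nonneg.2 (hfeasτ i))
  calc _ ≤ bbar * W / (blo * W) :=
        div_le_div₀ (mul_nonneg (hblo.le.trans hlohi) hW.le) hnum (mul_pos hblo hW) hden
    _ = bbar / blo := mul_div_mul_right _ _ hW.ne'
end

section
/- Let A ≥ 1 and I be natural numbers with I > A, and let d > 0, σ ≥ 0, ε > 0 be real numbers. For f ∈ [σ + ε, σ + ε + (⌈I/A⌉ − 1)·d], let F(f) ∈ [0,1] be the unique solution of ∑_{n=0}^{I−1} (I−1 choose n) · (1−F)^n · F^{I−1−n} · (f + ⌈(n+1)/A⌉·d) = σ + ε + ⌈I/A⌉·d. Then the map f ↦ F(f) is monotone nondecreasing on [σ + ε, σ + ε + (⌈I/A⌉ − 1)·d], with F(σ + ε) = 0 and F(σ + ε + (⌈I/A⌉ − 1)·d) = 1; in particular it defines a valid cumulative distribution function supported on this interval. -/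
/-- The expectation of `c X` for `X` binomially distributed with parameters `N` and `p`. -/
noncomputable def binomialMean (N : ℕ) (c : ℕ → ℝ) (p : ℝ) : ℝ :=
  ∑ n ∈ Finset.range (N + 1), (N.choose n : ℝ) * p ^ n * (1 - p) ^ (N - n) * c n

theorem binomialMean_zero_left (c : ℕ → ℝ) (p : ℝ) : binomialMean 0 c p = c 0 := by
  simp [binomialMean]

theorem binomialMean_succ (N : ℕ) (c : ℕ → ℝ) (p : ℝ) :
    binomialMean (N + 1) c p =
      (1 - p) * binomialMean N c p + p * binomialMean N (fun n => c (n + 1)) p := by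
  have key : ∀ (M : ℕ) (b : ℕ → ℝ), binomialMean M b p =
      ∑ ij ∈ Finset.HasAntidiagonal.antidiagonal M,
        (M.choose ij.1 : ℝ) * (p ^ ij.1 * (1 - p) ^ ij.2 * b ij.1) := by
    intro M b
    rw [Finset.Nat.sum_antidiagonal_eq_sum_range_succ_mk]
    simp only [binomialMean, mul_assoc]
  rw [key, key, key, Finset.sum_antidiagonal_choose_succ_mul
    (fun i j => p ^ i * (1 - p) ^ j * c i), Finset.mul_sum, Finset.mul_sum]
  congr 1
  · refine Finset.sum_congr rfl fun ij _ => ?_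
    ring
  · refine Finset.sum_congr rfl fun ij hij => ?_
    rw [Nat.choose_symm_of_eq_add (Finset.HasAntidiagonal.mem_antidiagonal.mp hij).symm]
    ring

theorem binomialMean_zero_right (N : ℕ) (c : ℕ → ℝ) : binomialMean N c 0 = c 0 := by
  induction N with
  | zero => exact binomialMean_zero_left c 0
  | succ N ih => rw [binomialMean_succ, ih]; ring

theorem binomialMean_one_right (N : ℕ) (c : ℕ → ℝ) : binomialMean N c 1 = c N := by
  induction N generalizing c with
  | zero => exact binomialMean_zero_left c 1
  | succ N ih => rw [binomialMean_succ, ih, ih]; ring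

theorem binomialMean_le_binomialMean (N : ℕ) {b c : ℕ → ℝ} (h : ∀ n, b n ≤ c n) {p : ℝ}
    (hp : p ∈ Set.Icc (0 : ℝ) 1) : binomialMean N b p ≤ binomialMean N c p := by
  have h₀ : 0 ≤ p := hp.1
  have h₁ : 0 ≤ 1 - p := sub_nonneg.mpr hp.2
  unfold binomialMean
  gcongr with n
  exact h n

theorem monotoneOn_binomialMean (N : ℕ) {c : ℕ → ℝ} (hc : Monotone c) :
    MonotoneOn (binomialMean N c) (Set.Icc 0 1) := by
  induction N generalizing c with
  | zero =>
    intro p _ q _ _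
    rw [binomialMean_zero_left, binomialMean_zero_left]
  | succ N ih =>
    intro p hp q hq hpq
    have hc' : Monotone fun n => c (n + 1) := fun m n h => hc (Nat.succ_le_succ h)
    have h₁ := ih hc hp hq hpq
    have h₂ := ih hc' hp hq hpq
    have h₃ := binomialMean_le_binomialMean N (fun n => hc n.le_succ) hq
    rw [binomialMean_succ, binomialMean_succ]
    nlinarith [mul_nonneg (sub_nonneg.mpr hp.2) (sub_nonneg.mpr h₁),
      mul_nonneg hp.1 (sub_nonneg.mpr h₂), mul_nonneg (sub_nonneg.mpr hpq) (sub_nonneg.mpr h₃)]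

theorem strictMonoOn_binomialMean (N : ℕ) {c : ℕ → ℝ} (hc : Monotone c) (hN : c 0 < c N) :
    StrictMonoOn (binomialMean N c) (Set.Icc 0 1) := by
  induction N generalizing c with
  | zero => exact absurd hN (lt_irrefl _)
  | succ N ih =>
    intro p hp q hq hpq
    have hc' : Monotone fun n => c (n + 1) := fun m n h => hc (Nat.succ_le_succ h)
    have h₁ := monotoneOn_binomialMean N hc hp hq hpq.le
    have h₂ := monotoneOn_binomialMean N hc' hp hq hpq.le
    have hp₁ : 0 < 1 - p := by linarith [hq.2]
    have hq₀ : 0 < q := hp.1.trans_lt hpq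
    rw [binomialMean_succ, binomialMean_succ]
    rcases Nat.eq_zero_or_pos N with rfl | hpos
    · simp only [binomialMean_zero_left]
      nlinarith [mul_pos (sub_pos.mpr hpq) (sub_pos.mpr hN)]
    · by_cases h0 : c 0 < c N
      · have h₃ := binomialMean_le_binomialMean N (fun n => hc n.le_succ) hq
        nlinarith [mul_pos hp₁ (sub_pos.mpr (ih hc h0 hp hq hpq)),
          mul_nonneg hp.1 (sub_nonneg.mpr h₂),
          mul_nonneg (sub_nonneg.mpr hpq.le) (sub_nonneg.mpr h₃)]
      · have h1 : c (0 + 1) < c (N + 1) := by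
          linarith [hc (show 0 + 1 ≤ N from hpos)]
        have h₃ := binomialMean_le_binomialMean N (fun n => hc n.le_succ) hp
        nlinarith [mul_pos hq₀ (sub_pos.mpr (ih hc' h1 hp hq hpq)),
          mul_nonneg (sub_nonneg.mpr hq.2) (sub_nonneg.mpr h₁),
          mul_nonneg (sub_nonneg.mpr hpq.le) (sub_nonneg.mpr h₃)]

/-- The equilibrium fee distribution is a valid CDF: if `F f` solves the indifference
equation for each `f` in the support interval `[σ+ε, σ+ε+(⌈I/A⌉−1)d]` and takes
values in `[0,1]`, then `F` is monotone nondecreasing there and attains `0` at the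
lower endpoint and `1` at the upper endpoint. -/
theorem equilibrium_cdf_valid
    (I A : ℕ) (hA : 1 ≤ A) (hIA : A < I)
    (d σ ε : ℝ) (hd : 0 < d) (hσ : 0 ≤ σ) (hε : 0 < ε)
    (F : ℝ → ℝ)
    (hF_mem : ∀ f ∈ Set.Icc (σ + ε)
        (σ + ε + ((⌈(I : ℝ) / (A : ℝ)⌉ : ℝ) - 1) * d),
      F f ∈ Set.Icc (0 : ℝ) 1)
    (hF_sol : ∀ f ∈ Set.Icc (σ + ε)
        (σ + ε + ((⌈(I : ℝ) / (A : ℝ)⌉ : ℝ) - 1) * d),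
      ∑ n ∈ Finset.range I,
          ((I - 1).choose n : ℝ) * (1 - F f) ^ n * (F f) ^ (I - 1 - n)
            * (f + (⌈((n : ℝ) + 1) / (A : ℝ)⌉ : ℝ) * d)
        = σ + ε + (⌈(I : ℝ) / (A : ℝ)⌉ : ℝ) * d) :
    MonotoneOn F (Set.Icc (σ + ε)
        (σ + ε + ((⌈(I : ℝ) / (A : ℝ)⌉ : ℝ) - 1) * d))
    ∧ F (σ + ε) = 0
    ∧ F (σ + ε + ((⌈(I : ℝ) / (A : ℝ)⌉ : ℝ) - 1) * d) = 1 := by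
  obtain ⟨N, rfl⟩ : ∃ N, I = N + 1 := ⟨I - 1, by omega⟩
  have hA' : (1 : ℝ) ≤ A := by exact_mod_cast hA
  have hA₀ : (0 : ℝ) < A := by linarith
  have hIA' : (A : ℝ) < (N : ℝ) + 1 := by exact_mod_cast hIA
  have hfirst : ⌈((0 : ℕ) + 1 : ℝ) / (A : ℝ)⌉ = 1 := by
    rw [Int.ceil_eq_iff]
    constructor
    · norm_num
      exact hA
    · rw [div_le_iff₀ hA₀]
      push_cast
      linarith
  have hlast : 1 < ⌈((N : ℝ) + 1) / (A : ℝ)⌉ := by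
    rw [Int.lt_ceil, lt_div_iff₀ hA₀]
    push_cast
    linarith
  set K : ℤ := ⌈((N + 1 : ℕ) : ℝ) / (A : ℝ)⌉ with hK
  have hKN : ⌈((N : ℝ) + 1) / (A : ℝ)⌉ = K := by rw [hK]; push_cast; rfl
  have hK₁ : (1 : ℝ) < K := by rw [hKN] at hlast; exact_mod_cast hlast
  set cost : ℝ → ℕ → ℝ := fun f n => f + (⌈((n : ℝ) + 1) / (A : ℝ)⌉ : ℝ) * d with hcost
  have hcost_zero : ∀ f, cost f 0 = f + d := by
    intro f
    simp only [hcost, hfirst]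
    push_cast
    ring
  have hcost_last : ∀ f, cost f N = f + K * d := by
    intro f
    simp only [hcost, hKN]
  have hcost_mono : ∀ f, Monotone (cost f) := by
    intro f m n hmn
    simp only [hcost]
    gcongr
  have hstrict : ∀ f, StrictMonoOn (binomialMean N (cost f)) (Set.Icc 0 1) := fun f =>
    strictMonoOn_binomialMean N (hcost_mono f) (by
      rw [hcost_zero, hcost_last]
      nlinarith)
  have hmem : ∀ f ∈ Set.Icc (σ + ε) (σ + ε + ((K : ℝ) - 1) * d),
      1 - F f ∈ Set.Icc (0 : ℝ) 1 := by
    intro f hf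
    obtain ⟨h₀, h₁⟩ := hF_mem f hf
    exact ⟨by linarith, by linarith⟩
  have hsol : ∀ f ∈ Set.Icc (σ + ε) (σ + ε + ((K : ℝ) - 1) * d),
      binomialMean N (cost f) (1 - F f) = σ + ε + K * d := by
    intro f hf
    rw [← hF_sol f hf]
    simp [binomialMean, hcost]
  have hle : σ + ε ≤ σ + ε + ((K : ℝ) - 1) * d := by nlinarith
  refine ⟨fun f hf g hg hfg => ?_, ?_, ?_⟩
  · by_contra! hlt
    have h₁ := hstrict g (hmem f hf) (hmem g hg) (by linarith)
    have h₂ : binomialMean N (cost f) (1 - F f) ≤ binomialMean N (cost g) (1 - F f) :=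
      binomialMean_le_binomialMean N (fun n => by simp only [hcost]; gcongr) (hmem f hf)
    rw [hsol g hg] at h₁
    rw [hsol f hf] at h₂
    linarith
  · have hf := Set.left_mem_Icc.mpr hle
    have h := (hstrict (σ + ε)).injOn (hmem _ hf) (Set.right_mem_Icc.mpr zero_le_one)
      (by rw [hsol _ hf, binomialMean_one_right, hcost_last])
    linarith
  · have hf := Set.right_mem_Icc.mpr hle
    have h := (hstrict _).injOn (hmem _ hf) (Set.left_mem_Icc.mpr zero_le_one)
      (by rw [hsol _ hf, binomialMean_zero_right, hcost_zero]; ring)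
    linarith
end
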